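/- arXiv:2202.01774 — 2 statements merged into one kernel-verified Lean document; each statement's English description precedes it below -/
import Mathlib

section
/- Let f : M → ℝ be the moment map component on a compact space and suppose a signed measure ν on ℝⁿ is a finite ℤ-linear combination of cone measures cone(μᵢ, Pᵢ) with all vectors of all Pᵢ contained in the open half-space {w : ⟨v,w⟩ > 0}; if ν is also compactly supported as a measure (i.e., equals a compactly supported measure), then applying all differencing operators Π ∂_λ over λ ∈ ∪Pᵢ to ν gives a compactly supported measure, and ν is uniquely determined among such linear combinations by its values on compact sets. -/
open MeasureTheory
open scoped RealInnerProductSpace Pointwise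

/-- The cone measure `cone(μ, P)`: the pushforward of Lebesgue measure on `(ℝ_{≥0})^P`
under `(x_λ) ↦ μ + Σ_λ x_λ • λ`, where the finite multiset `P` is given as a list. -/
noncomputable def coneMeasure {n : ℕ} (μ : EuclideanSpace ℝ (Fin n))
    (P : List (EuclideanSpace ℝ (Fin n))) : Measure (EuclideanSpace ℝ (Fin n)) :=
  Measure.map (fun x : Fin P.length → ℝ => μ + ∑ i, x i • P.get i)
    (volume.restrict {x : Fin P.length → ℝ | ∀ i, 0 ≤ x i})

/-- A cone term: an integer coefficient, an apex, and a list of generating vectors. -/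
abbrev ConeTerm (n : ℕ) : Type :=
  ℤ × EuclideanSpace ℝ (Fin n) × List (EuclideanSpace ℝ (Fin n))

/-- The value of the cone term `c • cone(μ,P)` on a set `s`. -/
noncomputable def termVal {n : ℕ} (t : ConeTerm n) (s : Set (EuclideanSpace ℝ (Fin n))) :
    ℝ := (t.1 : ℝ) * (coneMeasure t.2.1 t.2.2 s).toReal

/-- The value of a finite `ℤ`-linear combination of cone terms on a set `s`. -/
noncomputable def comboVal {n : ℕ} (L : List (ConeTerm n))
    (s : Set (EuclideanSpace ℝ (Fin n))) : ℝ := (L.map (fun t => termVal t s)).sum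

/-- The result of applying the composite differencing operator `Π_{λ ∈ Λ} ∂_λ`
(where `∂_λ ν = ν - (translate of ν by λ)`) to the combination `L`, evaluated on `s`:
`Σ_{S ⊆ Λ} (-1)^{|S|} ν(s + Σ S)`. -/
noncomputable def diffVal {n : ℕ} (L : List (ConeTerm n))
    (Λ : List (EuclideanSpace ℝ (Fin n))) (s : Set (EuclideanSpace ℝ (Fin n))) : ℝ :=
  (Λ.sublists.map (fun S =>
    (-1 : ℝ) ^ S.length * comboVal L ((fun x => x + S.sum) '' s))).sum

/-- A cone measure whose generators lie in an open half-space is finite on bounded sets. -/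
theorem coneMeasure_lt_top_of_isBounded {n : ℕ} {v : EuclideanSpace ℝ (Fin n)}
    {P : List (EuclideanSpace ℝ (Fin n))} (hP : ∀ w ∈ P, 0 < ⟪v, w⟫)
    (μ : EuclideanSpace ℝ (Fin n)) {s : Set (EuclideanSpace ℝ (Fin n))}
    (hs : MeasurableSet s) (hb : Bornology.IsBounded s) : coneMeasure μ P s < ⊤ := by
  obtain ⟨C, hC⟩ := hb.exists_norm_le
  have hm : Measurable (fun x : Fin P.length → ℝ => μ + ∑ i, x i • P.get i) := by
    fun_prop
  rw [coneMeasure, Measure.map_apply hm hs, Measure.restrict_apply (hm hs)]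
  have hpos : ∀ i : Fin P.length, 0 < ⟪v, P.get i⟫ := fun i => hP _ (P.get_mem i)
  refine lt_of_le_of_lt (measure_mono (t := Set.Icc 0
    (fun i => (‖v‖ * C - ⟪v, μ⟫) / ⟪v, P.get i⟫)) ?_) isCompact_Icc.measure_lt_top
  rintro x ⟨hx, hx0⟩
  refine ⟨hx0, fun i => ?_⟩
  rw [le_div_iff₀ (hpos i)]
  have h1 : ⟪v, μ + ∑ i, x i • P.get i⟫ ≤ ‖v‖ * C :=
    (real_inner_le_norm _ _).trans (mul_le_mul_of_nonneg_left (hC _ hx) (norm_nonneg v))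
  rw [inner_add_right, inner_sum] at h1
  simp only [real_inner_smul_right] at h1
  have h2 : x i * ⟪v, P.get i⟫ ≤ ∑ j, x j * ⟪v, P.get j⟫ :=
    Finset.single_le_sum (f := fun j => x j * ⟪v, P.get j⟫)
      (fun j _ => mul_nonneg (hx0 j) (hpos j).le) (Finset.mem_univ i)
  linarith

/-- Restricted to a bounded set, a combination of cone measures with generators in an open
half-space is a signed measure. -/
theorem exists_signedMeasure_eq_comboVal_inter {n : ℕ} {v : EuclideanSpace ℝ (Fin n)}
    {B : Set (EuclideanSpace ℝ (Fin n))} (hB : MeasurableSet B) (hb : Bornology.IsBounded B)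
    (L : List (ConeTerm n)) (hL : ∀ t ∈ L, ∀ w ∈ t.2.2, 0 < ⟪v, w⟫) :
    ∃ σ : SignedMeasure (EuclideanSpace ℝ (Fin n)),
      ∀ s, MeasurableSet s → σ s = comboVal L (s ∩ B) := by
  induction L with
  | nil => exact ⟨0, fun s _ => by simp [comboVal]⟩
  | cons t L ih =>
    obtain ⟨σ, hσ⟩ := ih fun t ht => hL t (List.mem_cons_of_mem _ ht)
    have : IsFiniteMeasure ((coneMeasure t.2.1 t.2.2).restrict B) :=
      ⟨by simpa using coneMeasure_lt_top_of_isBounded (hL t List.mem_cons_self) t.2.1 hB hb⟩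
    refine ⟨(t.1 : ℝ) • ((coneMeasure t.2.1 t.2.2).restrict B).toSignedMeasure + σ,
      fun s hs => ?_⟩
    simp [comboVal, termVal, hσ s hs, Measure.toSignedMeasure_apply_measurable hs,
      Measure.real, Measure.restrict_apply hs]

/-- Signed measures on a Borel space that agree on closed sets are equal. -/
theorem MeasureTheory.SignedMeasure.ext_of_isClosed {X : Type*} [TopologicalSpace X]
    [MeasurableSpace X] [BorelSpace X] {σ τ : SignedMeasure X}
    (h : ∀ s, IsClosed s → σ s = τ s) : σ = τ := by
  refine VectorMeasure.ext fun s hs => ?_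
  induction s, hs using MeasurableSpace.induction_on_inter
    ((BorelSpace.measurable_eq (α := X)).trans borel_eq_generateFrom_isClosed)
    isPiSystem_isClosed with
  | empty => simp
  | basic s hs => exact h s hs
  | compl s hs ih =>
    have h1 := VectorMeasure.of_add_of_sdiff (v := σ) hs MeasurableSet.univ (Set.subset_univ s)
    have h2 := VectorMeasure.of_add_of_sdiff (v := τ) hs MeasurableSet.univ (Set.subset_univ s)
    rw [← Set.compl_eq_univ_sdiff] at h1 h2
    linarith [h Set.univ isClosed_univ]
  | iUnion f hd hf ih =>
    rw [VectorMeasure.of_disjoint_iUnion hf hd, VectorMeasure.of_disjoint_iUnion hf hd]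
    exact tsum_congr ih

/-- Let `ν` be a finite `ℤ`-linear combination of cone measures `cone(μᵢ,Pᵢ)` with all
vectors of all `Pᵢ` in the open half-space `{w : ⟪v,w⟫ > 0}`, and suppose `ν` is
compactly supported.  Then (a) applying all differencing operators `Π ∂_λ` over
`λ ∈ ∪ Pᵢ` to `ν` yields a compactly supported measure, and (b) `ν` is uniquely
determined among such linear combinations by its values on compact sets. -/
theorem cone_combination_differencing_and_uniqueness {n : ℕ} (L : List (ConeTerm n))
    (v : EuclideanSpace ℝ (Fin n))
    (hL : ∀ t ∈ L, ∀ w ∈ t.2.2, 0 < ⟪v, w⟫)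
    (hcpt : ∃ K : Set (EuclideanSpace ℝ (Fin n)), IsCompact K ∧
      ∀ s : Set (EuclideanSpace ℝ (Fin n)), MeasurableSet s → Bornology.IsBounded s →
        Disjoint s K → comboVal L s = 0) :
    (∃ K' : Set (EuclideanSpace ℝ (Fin n)), IsCompact K' ∧
      ∀ s : Set (EuclideanSpace ℝ (Fin n)), MeasurableSet s → Bornology.IsBounded s →
        Disjoint s K' → diffVal L (L.map (fun t => t.2.2)).flatten s = 0) ∧
    (∀ L' : List (ConeTerm n), (∀ t ∈ L', ∀ w ∈ t.2.2, 0 < ⟪v, w⟫) →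
      (∀ s : Set (EuclideanSpace ℝ (Fin n)), IsCompact s → comboVal L s = comboVal L' s) →
      ∀ s : Set (EuclideanSpace ℝ (Fin n)), MeasurableSet s → Bornology.IsBounded s →
        comboVal L s = comboVal L' s) := by
  refine ⟨?_, fun L' hL' heq s hs hsb => ?_⟩
  · obtain ⟨K, hK, hvan⟩ := hcpt
    set Λ := (L.map (fun t => t.2.2)).flatten
    refine ⟨⋃ S ∈ {S | S ∈ Λ.sublists}, (fun x => x - S.sum) '' K,
      (List.finite_toSet _).isCompact_biUnion fun S _ => hK.image (by fun_prop),
      fun s hs hsb hd => ?_⟩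
    refine List.sum_eq_zero fun r hr => ?_
    obtain ⟨S, hS, rfl⟩ := List.mem_map.1 hr
    rw [hvan, mul_zero]
    · exact (MeasurableEquiv.addRight S.sum).measurableSet_image.2 hs
    · exact ((LipschitzWith.id.add (LipschitzWith.const S.sum)).isBounded_image hsb)
    · rw [Set.disjoint_left]
      rintro _ ⟨x, hx, rfl⟩ hxK
      exact Set.disjoint_left.1 hd hx
        (Set.mem_biUnion (show S ∈ {S | S ∈ Λ.sublists} from hS) ⟨_, hxK, by simp⟩)
  · have hc : IsCompact (closure s) := hsb.isCompact_closure
    have hB := hc.isClosed.measurableSet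
    obtain ⟨σ, hσ⟩ := exists_signedMeasure_eq_comboVal_inter hB hc.isBounded L hL
    obtain ⟨τ, hτ⟩ := exists_signedMeasure_eq_comboVal_inter hB hc.isBounded L' hL'
    have hστ : σ = τ := SignedMeasure.ext_of_isClosed fun F hF => by
      rw [hσ F hF.measurableSet, hτ F hF.measurableSet]
      exact heq _ (hc.inter_left hF)
    rw [← Set.inter_eq_left.2 (subset_closure (s := s)), ← hσ s hs, ← hτ s hs, hστ]
end

section
/- The characteristic-cycle inclusion–exclusion for indicator functions of orbits: for a polytope P and its face lattice, the indicator of the relative interior of any face E satisfies 1_{relint E} = Σ_{F ⊆ E} (−1)^{dim E − dim F} 1_F, where the sum is over all nonempty faces F of E and 1_F is the indicator of the closed face F. -/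
open scoped Finset

/-- `g : ℝ → ℤ` has total jump `c` if summing `g t - g (t + ε)` over every sufficiently large
finite set of abscissae `t`, for small `ε > 0`, yields `c`. -/
def HasTotalJump (g : ℝ → ℤ) (c : ℤ) : Prop :=
  ∃ Q : Finset ℝ, ∀ P : Finset ℝ, Q ⊆ P → ∀ ε : ℝ, 0 < ε →
    (∀ p ∈ P, ∀ q ∈ P, p < q → p + ε < q) → ∑ t ∈ P, (g t - g (t + ε)) = c

theorem exists_pos_add_lt_of_lt (P : Finset ℝ) :
    ∃ ε : ℝ, 0 < ε ∧ ∀ p ∈ P, ∀ q ∈ P, p < q → p + ε < q := by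
  induction P using Finset.induction_on with
  | empty => exact ⟨1, one_pos, by simp⟩
  | insert a P ha ih =>
    obtain ⟨ε, hε, h⟩ := ih
    have key : ∀ R : Finset ℝ, ∃ δ : ℝ, 0 < δ ∧ ∀ q ∈ R, q ≠ a → δ < |q - a| := by
      intro R
      induction R using Finset.induction_on with
      | empty => exact ⟨1, one_pos, by simp⟩
      | insert b R hb ihR =>
        obtain ⟨δ, hδ, h⟩ := ihR
        by_cases hba : b = a
        · refine ⟨δ, hδ, fun q hq hqa => ?_⟩
          rcases Finset.mem_insert.1 hq with rfl | hq
          · exact absurd hba hqa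
          · exact h q hq hqa
        · have hpos : 0 < |b - a| := abs_pos.2 (sub_ne_zero.2 hba)
          refine ⟨min δ (|b - a| / 2), lt_min hδ (by linarith), fun q hq hqa => ?_⟩
          rcases Finset.mem_insert.1 hq with rfl | hq
          · exact (min_le_right _ _).trans_lt (by linarith)
          · exact (min_le_left _ _).trans_lt (h q hq hqa)
    obtain ⟨δ, hδ, hδ'⟩ := key P
    refine ⟨min ε δ, lt_min hε hδ, fun p hp q hq hpq => ?_⟩
    have h1 := min_le_left ε δ
    have h2 := min_le_right ε δ
    rcases Finset.mem_insert.1 hp with rfl | hp' <;> rcases Finset.mem_insert.1 hq with rfl | hq'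
    · exact absurd hpq (lt_irrefl _)
    · have := hδ' q hq' hpq.ne'
      rw [abs_of_pos (by linarith)] at this
      linarith
    · have := hδ' p hp' hpq.ne
      rw [abs_of_neg (by linarith)] at this
      linarith
    · have := h p hp' q hq' hpq
      linarith

namespace HasTotalJump

theorem unique {g : ℝ → ℤ} {c d : ℤ} (hc : HasTotalJump g c) (hd : HasTotalJump g d) : c = d := by
  obtain ⟨Q, hQ⟩ := hc
  obtain ⟨R, hR⟩ := hd
  obtain ⟨ε, hε, h⟩ := exists_pos_add_lt_of_lt (Q ∪ R)
  rw [← hQ _ Finset.subset_union_left ε hε h, ← hR _ Finset.subset_union_right ε hε h]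

theorem zero : HasTotalJump (fun _ => 0) 0 := ⟨∅, by simp⟩

theorem add {g g' : ℝ → ℤ} {c c' : ℤ} (hc : HasTotalJump g c) (hc' : HasTotalJump g' c') :
    HasTotalJump (fun t => g t + g' t) (c + c') := by
  obtain ⟨Q, hQ⟩ := hc
  obtain ⟨R, hR⟩ := hc'
  refine ⟨Q ∪ R, fun P hP ε hε h => ?_⟩
  rw [← hQ P (Finset.union_subset_left hP) ε hε h, ← hR P (Finset.union_subset_right hP) ε hε h,
    ← Finset.sum_add_distrib]
  exact Finset.sum_congr rfl fun t _ => by ring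

theorem sum {ι : Type*} (J : Finset ι) {g : ι → ℝ → ℤ} {c : ι → ℤ}
    (h : ∀ j ∈ J, HasTotalJump (g j) (c j)) :
    HasTotalJump (fun t => ∑ j ∈ J, g j t) (∑ j ∈ J, c j) := by
  classical
  induction J using Finset.induction_on with
  | empty => simpa using zero
  | insert a J ha ih =>
    simp only [Finset.sum_insert ha]
    exact (h a (Finset.mem_insert_self _ _)).add
      (ih fun j hj => h j (Finset.mem_insert_of_mem hj))

theorem const_mul {g : ℝ → ℤ} {c : ℤ} (z : ℤ) (hc : HasTotalJump g c) :
    HasTotalJump (fun t => z * g t) (z * c) := by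
  obtain ⟨Q, hQ⟩ := hc
  refine ⟨Q, fun P hP ε hε h => ?_⟩
  rw [← hQ P hP ε hε h, Finset.mul_sum]
  exact Finset.sum_congr rfl fun t _ => by ring

theorem indicator_singleton (a : ℝ) : HasTotalJump (({a} : Set ℝ).indicator 1) 1 := by
  classical
  refine ⟨{a}, fun P hP ε hε h => ?_⟩
  have ha : a ∈ P := hP (by simp)
  rw [Finset.sum_congr rfl (g := fun t => if t = a then 1 else 0)]
  · simp [ha]
  · intro t ht
    have h2 := h t ht a ha
    simp only [Set.indicator_apply, Set.mem_singleton_iff, Pi.one_apply]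
    have : t + ε ≠ a := fun e => by linarith [h2 (by linarith)]
    simp [this]

theorem indicator_Icc {a b : ℝ} (hab : a ≤ b) : HasTotalJump ((Set.Icc a b).indicator 1) 1 := by
  classical
  refine ⟨{a, b}, fun P hP ε hε h => ?_⟩
  have ha : a ∈ P := hP (by simp)
  have hb : b ∈ P := hP (by simp)
  rw [Finset.sum_congr rfl (g := fun t => if t = b then 1 else 0)]
  · simp [hb]
  · intro t ht
    have h1 : a ≤ t + ε ↔ a ≤ t :=
      ⟨fun h' => by by_contra! h3; linarith [h t ht a ha h3], fun h' => by linarith⟩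
    have h2 : t + ε ≤ b ↔ t < b := ⟨fun h' => by linarith, fun h' => (h t ht b hb h').le⟩
    simp only [Set.indicator_apply, Set.mem_Icc, Pi.one_apply, h1, h2]
    grind

theorem indicator_Ioo {a b : ℝ} (hab : a < b) : HasTotalJump ((Set.Ioo a b).indicator 1) (-1) := by
  classical
  refine ⟨{a, b}, fun P hP ε hε h => ?_⟩
  have ha : a ∈ P := hP (by simp)
  have hb : b ∈ P := hP (by simp)
  rw [Finset.sum_congr rfl (g := fun t => if t = a then -1 else 0)]
  · simp [ha]
  · intro t ht
    have h1 : a < t + ε ↔ a ≤ t :=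
      ⟨fun h' => by by_contra! h3; linarith [h t ht a ha h3], fun h' => by linarith⟩
    have h2 : t + ε < b ↔ t < b := ⟨fun h' => by linarith, fun h' => h t ht b hb h'⟩
    simp only [Set.indicator_apply, Set.mem_Ioo, Pi.one_apply, h1, h2]
    grind

end HasTotalJump

theorem IsConnected.eq_Ioo_of_isOpen {s : Set ℝ} (hs : IsConnected s) (ho : IsOpen s)
    (hb : BddBelow s) (ha : BddAbove s) : ∃ a b, a < b ∧ s = Set.Ioo a b := by
  have h1 : sInf s ∉ s := fun h => by
    obtain ⟨ε, hε, h'⟩ := Metric.isOpen_iff.1 ho _ h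
    have : sInf s - ε / 2 ∈ s := h' (by simp [abs_of_pos hε]; linarith)
    linarith [csInf_le hb this]
  have h2 : sSup s ∉ s := fun h => by
    obtain ⟨ε, hε, h'⟩ := Metric.isOpen_iff.1 ho _ h
    have : sSup s + ε / 2 ∈ s := h' (by simp [abs_of_pos hε]; linarith)
    linarith [le_csSup ha this]
  have h3 : s ⊆ Set.Ioo (sInf s) (sSup s) := fun x hx =>
    ⟨(csInf_le hb hx).lt_of_ne fun e => h1 (e ▸ hx), (le_csSup ha hx).lt_of_ne fun e => h2 (e ▸ hx)⟩
  obtain ⟨x, hx⟩ := hs.nonempty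
  exact ⟨sInf s, sSup s, (h3 hx).1.trans (h3 hx).2,
    h3.antisymm (hs.Ioo_csInf_csSup_subset hb ha)⟩

theorem Submodule.finrank_inf_ker_add_one {V : Type*} [AddCommGroup V] [Module ℝ V]
    [FiniteDimensional ℝ V] (D : Submodule ℝ V) (φ : V →ₗ[ℝ] ℝ) (h : ¬ D ≤ LinearMap.ker φ) :
    Module.finrank ℝ (D ⊓ LinearMap.ker φ : Submodule ℝ V) + 1 = Module.finrank ℝ D := by
  have h0 : φ.domRestrict D ≠ 0 := fun h0 => h fun x hx => by
    simpa using LinearMap.congr_fun h0 ⟨x, hx⟩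
  rw [← Module.Dual.finrank_ker_add_one_of_ne_zero h0, LinearMap.ker_domRestrict,
    ← Submodule.map_comap_subtype, ← (LinearEquiv.finrank_eq
      (Submodule.equivMapOfInjective D.subtype D.injective_subtype _))]

section LevelSet

variable {V : Type*} [NormedAddCommGroup V] [NormedSpace ℝ V]

/-- The level set `{x | φ x = φ p}` of a linear functional through `p`. -/
def levelSubspace (φ : StrongDual ℝ V) (p : V) : AffineSubspace ℝ V :=
  AffineSubspace.mk' p (LinearMap.ker (φ : V →ₗ[ℝ] ℝ))

theorem mem_levelSubspace {φ : StrongDual ℝ V} {p x : V} :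
    x ∈ levelSubspace φ p ↔ φ x = φ p := by
  simp [levelSubspace, AffineSubspace.mem_mk', sub_eq_zero]

theorem direction_inf_levelSubspace {S : AffineSubspace ℝ V} {φ : StrongDual ℝ V} {p x : V}
    (hS : x ∈ S) (hx : φ x = φ p) :
    (S ⊓ levelSubspace φ p).direction = S.direction ⊓ LinearMap.ker (φ : V →ₗ[ℝ] ℝ) := by
  rw [AffineSubspace.direction_inf_of_mem hS (mem_levelSubspace.2 hx), levelSubspace,
    AffineSubspace.direction_mk']

open Classical in
/-- The compactly supported Euler characteristic `(-1) ^ dim` of a relatively open convex set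
`S ∩ U`, where `S` is an affine subspace and `U` is an open convex set; it is `0` if `S ∩ U` is
empty. -/
noncomputable def relOpenEuler (S : AffineSubspace ℝ V) (U : Set V) : ℤ :=
  if ((S : Set V) ∩ U).Nonempty then (-1) ^ Module.finrank ℝ S.direction else 0

theorem relOpenEuler_of_nonempty {S : AffineSubspace ℝ V} {U : Set V}
    (h : ((S : Set V) ∩ U).Nonempty) :
    relOpenEuler S U = (-1) ^ Module.finrank ℝ S.direction := if_pos h

theorem relOpenEuler_of_not_nonempty {S : AffineSubspace ℝ V} {U : Set V}
    (h : ¬ ((S : Set V) ∩ U).Nonempty) : relOpenEuler S U = 0 := if_neg h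

theorem isOpen_image_inter {S : AffineSubspace ℝ V} {U : Set V} (hU : IsOpen U)
    {φ : StrongDual ℝ V} (hφ : ¬ S.direction ≤ LinearMap.ker (φ : V →ₗ[ℝ] ℝ)) :
    IsOpen (φ '' ((S : Set V) ∩ U)) := by
  obtain ⟨v, hv, hφv⟩ := SetLike.not_le_iff_exists.1 hφ
  replace hφv : φ v ≠ 0 := hφv
  rw [isOpen_iff_mem_nhds]
  rintro _ ⟨x, ⟨hxS, hxU⟩, rfl⟩
  have hc : Continuous fun t : ℝ => ((t - φ x) / φ v) • v + x := by fun_prop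
  have h0 : ((φ x - φ x) / φ v) • v + x ∈ U := by simpa using hxU
  filter_upwards [hc.continuousAt.preimage_mem_nhds (hU.mem_nhds h0)] with t ht
  refine ⟨_, ⟨AffineSubspace.vadd_mem_of_mem_direction (S.direction.smul_mem _ hv) hxS, ht⟩, ?_⟩
  simp [hφv]

theorem inf_levelSubspace_inter {S : AffineSubspace ℝ V} {U : Set V} {φ : StrongDual ℝ V} {p : V} :
    ((S ⊓ levelSubspace φ p : AffineSubspace ℝ V) : Set V) ∩ U =
      ((S : Set V) ∩ U) ∩ {x | φ x = φ p} := by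
  ext x
  simp only [Set.mem_inter_iff, SetLike.mem_coe, AffineSubspace.mem_inf_iff, mem_levelSubspace,
    Set.mem_ofPred_eq]
  tauto

/-- Slicing a bounded relatively open convex set: its Euler characteristic is the total jump of
the Euler characteristics of its slices. -/
theorem hasTotalJump_relOpenEuler [FiniteDimensional ℝ V] {S : AffineSubspace ℝ V} {U : Set V}
    (hUo : IsOpen U) (hUc : Convex ℝ U) {φ : StrongDual ℝ V} {σ : ℝ → V} (hσ : ∀ t, φ (σ t) = t)
    (hb : BddBelow (φ '' ((S : Set V) ∩ U))) (ha : BddAbove (φ '' ((S : Set V) ∩ U))) :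
    HasTotalJump (fun t => relOpenEuler (S ⊓ levelSubspace φ (σ t)) U) (relOpenEuler S U) := by
  classical
  have hne : ∀ t, (((S ⊓ levelSubspace φ (σ t) : AffineSubspace ℝ V) : Set V) ∩ U).Nonempty ↔
      t ∈ φ '' ((S : Set V) ∩ U) := fun t => by
    rw [inf_levelSubspace_inter, hσ]; rfl
  by_cases hSU : ((S : Set V) ∩ U).Nonempty
  swap
  · rw [relOpenEuler_of_not_nonempty hSU]
    convert HasTotalJump.zero with t
    refine relOpenEuler_of_not_nonempty fun h => hSU ?_
    exact ((hne t).1 h).imp fun _ h => h.1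
  rw [relOpenEuler_of_nonempty hSU]
  by_cases hφ : S.direction ≤ LinearMap.ker (φ : V →ₗ[ℝ] ℝ)
  · obtain ⟨p, hpS, hpU⟩ := hSU
    have himg : φ '' ((S : Set V) ∩ U) = {φ p} := by
      refine Set.eq_singleton_iff_unique_mem.2 ⟨⟨p, ⟨hpS, hpU⟩, rfl⟩, ?_⟩
      rintro _ ⟨x, ⟨hxS, -⟩, rfl⟩
      have : φ (x - p) = 0 := hφ (AffineSubspace.vsub_mem_direction hxS hpS)
      rwa [map_sub, sub_eq_zero] at this
    rw [← mul_one ((-1 : ℤ) ^ _)]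
    convert (HasTotalJump.indicator_singleton (φ p)).const_mul
      ((-1) ^ Module.finrank ℝ S.direction) using 2 with t
    by_cases ht : t = φ p
    · rw [relOpenEuler_of_nonempty ((hne t).2 (by rw [himg, ht]; rfl)),
        direction_inf_levelSubspace hpS (by rw [hσ, ht]), inf_eq_left.2 hφ]
      simp [ht]
    · rw [relOpenEuler_of_not_nonempty (fun h => ht (by simpa [himg] using (hne t).1 h))]
      simp [ht]
  · have hconn : IsConnected (φ '' ((S : Set V) ∩ U)) :=
      ⟨hSU.image _, ((S.convex.inter hUc).isPreconnected).image _ φ.continuous.continuousOn⟩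
    obtain ⟨a, b, hab, himg⟩ := hconn.eq_Ioo_of_isOpen (isOpen_image_inter hUo hφ) hb ha
    have hfr := Submodule.finrank_inf_ker_add_one S.direction _ hφ
    rw [← hfr, pow_succ]
    convert (HasTotalJump.indicator_Ioo hab).const_mul
      ((-1) ^ Module.finrank ℝ (S.direction ⊓ LinearMap.ker (φ : V →ₗ[ℝ] ℝ) : Submodule ℝ V))
      using 2 with t
    by_cases ht : t ∈ Set.Ioo a b
    · obtain ⟨x, ⟨hxS, -⟩, hx⟩ := himg ▸ ht
      rw [relOpenEuler_of_nonempty ((hne t).2 (himg ▸ ht)),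
        direction_inf_levelSubspace hxS (by rw [hσ, hx]), Set.indicator_of_mem ht]
      simp
    · rw [relOpenEuler_of_not_nonempty (fun h => ht (himg ▸ (hne t).1 h)),
        Set.indicator_of_notMem ht]
      simp

open Classical in
theorem hasTotalJump_compact_convex {K : Set V} (hK : IsCompact K) (hKc : Convex ℝ K)
    (φ : StrongDual ℝ V) :
    HasTotalJump (fun t => if (K ∩ {x | φ x = t}).Nonempty then 1 else 0)
      (if K.Nonempty then 1 else 0) := by
  by_cases hne : K.Nonempty
  · have hconn : IsConnected (φ '' K) :=
      ⟨hne.image _, hKc.isPreconnected.image _ φ.continuous.continuousOn⟩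
    have himg := eq_Icc_of_connected_compact hconn (hK.image φ.continuous)
    rw [if_pos hne]
    convert HasTotalJump.indicator_Icc (Set.nonempty_Icc.1 (himg ▸ hne.image φ)) using 2 with t
    rw [← himg, Set.indicator_apply]
    rfl
  · rw [if_neg hne]
    convert HasTotalJump.zero with t
    exact if_neg fun h => hne (h.mono Set.inter_subset_left)

open Classical in
/-- Euler's relation: if a compact convex set is the disjoint union of relatively open convex
sets, then the Euler characteristics of the pieces sum to that of the compact set. -/
theorem sum_relOpenEuler_eq_of_partition [FiniteDimensional ℝ V] {ι : Type*} (J : Finset ι)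
    (U : ι → Set V) (hUo : ∀ j ∈ J, IsOpen (U j)) (hUc : ∀ j ∈ J, Convex ℝ (U j))
    (S : ι → AffineSubspace ℝ V) (K : Set V) (hK : IsCompact K) (hKc : Convex ℝ K)
    (h : ∀ x, K.indicator (1 : V → ℤ) x = ∑ j ∈ J, ((S j : Set V) ∩ U j).indicator (1 : V → ℤ) x) :
    ∑ j ∈ J, relOpenEuler (S j) (U j) = if K.Nonempty then 1 else 0 := by
  suffices H : ∀ (d : ℕ) (T : AffineSubspace ℝ V), Module.finrank ℝ T.direction = d →
      ∀ (S : ι → AffineSubspace ℝ V) (K : Set V), IsCompact K → Convex ℝ K →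
      (∀ j ∈ J, S j ≤ T) → (∀ x, K.indicator (1 : V → ℤ) x =
        ∑ j ∈ J, ((S j : Set V) ∩ U j).indicator (1 : V → ℤ) x) →
      ∑ j ∈ J, relOpenEuler (S j) (U j) = if K.Nonempty then 1 else 0 from
    H _ ⊤ rfl S K hK hKc (fun _ _ => le_top) h
  clear h hKc hK K S
  intro d
  induction d using Nat.strong_induction_on with
  | _ d ih =>
  intro T hT S K hK hKc hST h
  have hsub : ∀ j ∈ J, (S j : Set V) ∩ U j ⊆ K := fun j hj x hx => by
    by_contra hxK
    have h0 := h x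
    rw [Set.indicator_of_notMem hxK] at h0
    have := (Finset.sum_eq_zero_iff_of_nonneg fun i _ =>
      Set.indicator_nonneg (fun _ _ => zero_le_one) x).1 h0.symm j hj
    rw [Set.indicator_of_mem hx] at this
    exact one_ne_zero this
  by_cases hbot : T.direction = ⊥
  · have hunique : ∀ x ∈ T, ∀ y ∈ T, x = y := fun x hx y hy => by
      have := AffineSubspace.vsub_mem_direction hx hy
      rw [hbot, Submodule.mem_bot] at this
      simpa [sub_eq_zero] using this
    by_cases hTne : (T : Set V).Nonempty
    · obtain ⟨p, hp⟩ := hTne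
      have hKT : K ⊆ T := fun x hx => by
        have h0 := h x
        rw [Set.indicator_of_mem hx] at h0
        obtain ⟨j, hj, hj'⟩ := Finset.exists_ne_zero_of_sum_ne_zero
          (h0 ▸ one_ne_zero : (∑ j ∈ J, ((S j : Set V) ∩ U j).indicator (1 : V → ℤ) x) ≠ 0)
        exact hST j hj (Set.mem_of_indicator_ne_zero hj').1
      have hmem : ∀ A : Set V, A ⊆ T → (A.Nonempty ↔ p ∈ A) := fun A hA =>
        ⟨fun ⟨x, hx⟩ => hunique x (hA hx) p hp ▸ hx, fun hpA => ⟨p, hpA⟩⟩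
      have h0 := h p
      rw [Set.indicator_apply, ← hmem K hKT] at h0
      refine Eq.trans (Finset.sum_congr rfl fun j hj => ?_) h0.symm
      have hjT : (S j : Set V) ∩ U j ⊆ T := fun x hx => hST j hj hx.1
      have : (S j).direction = ⊥ := le_bot_iff.1 (hbot ▸ AffineSubspace.direction_le (hST j hj))
      have hd : Module.finrank ℝ (S j).direction = 0 := by rw [this, finrank_bot]
      simp only [relOpenEuler, Set.indicator_apply, hmem _ hjT, hd]
      simp
    · have hempty : ∀ j ∈ J, ¬ ((S j : Set V) ∩ U j).Nonempty := fun j hj ⟨x, hx⟩ =>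
        hTne ⟨x, hST j hj hx.1⟩
      rw [Finset.sum_eq_zero fun j hj => relOpenEuler_of_not_nonempty (hempty j hj), if_neg]
      rintro ⟨x, hx⟩
      have h0 := h x
      rw [Set.indicator_of_mem hx, Finset.sum_eq_zero fun j hj =>
        Set.indicator_of_notMem (fun hx => hempty j hj ⟨x, hx⟩) _] at h0
      exact one_ne_zero h0
  · obtain ⟨v, hv, hv0⟩ := Submodule.exists_mem_ne_zero_of_ne_bot hbot
    obtain ⟨φ, hφv⟩ := SeparatingDual.exists_ne_zero (R := ℝ) hv0
    set σ : ℝ → V := fun t => (t / φ v) • v with hσdef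
    have hσ : ∀ t, φ (σ t) = t := fun t => by simp [hσdef, hφv]
    have hslice : ∀ t, ∑ j ∈ J, relOpenEuler (S j ⊓ levelSubspace φ (σ t)) (U j) =
        if (K ∩ {x | φ x = t}).Nonempty then 1 else 0 := by
      intro t
      have hlt : (T ⊓ levelSubspace φ (σ t)).direction < T.direction := by
        refine lt_of_le_of_ne (AffineSubspace.direction_le inf_le_left) fun e => hφv ?_
        have := AffineSubspace.direction_le
          (inf_le_right : T ⊓ levelSubspace φ (σ t) ≤ _) (e ▸ hv)
        rwa [levelSubspace, AffineSubspace.direction_mk'] at this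
      refine ih _ (hT ▸ Submodule.finrank_lt_finrank_of_lt hlt) _ rfl
        (fun j => S j ⊓ levelSubspace φ (σ t)) _
        (hK.inter_right (isClosed_eq φ.continuous continuous_const))
        (hKc.inter ((convex_singleton t).linear_preimage (φ : V →ₗ[ℝ] ℝ)))
        (fun j hj => inf_le_inf_right _ (hST j hj)) fun x => ?_
      simp only [inf_levelSubspace_inter, hσ]
      by_cases hx : φ x = t
      · simpa [Set.indicator_apply, hx] using h x
      · simp [hx]
    have hbdd := hK.image φ.continuous
    have h1 := HasTotalJump.sum J fun j hj =>
      hasTotalJump_relOpenEuler (hUo j hj) (hUc j hj) hσ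
        (hbdd.bddBelow.mono (Set.image_mono (hsub j hj)))
        (hbdd.bddAbove.mono (Set.image_mono (hsub j hj)))
    simp only [hslice] at h1
    exact h1.unique (hasTotalJump_compact_convex hK hKc φ)

end LevelSet

section Polytope

open scoped RealInnerProductSpace

variable {V : Type*} [NormedAddCommGroup V] [InnerProductSpace ℝ V]

/-- A point of a convex set is in its relative interior iff no nonzero linear functional on the
direction of the set attains its maximum there. -/
theorem mem_intrinsicInterior_iff_forall_inner [FiniteDimensional ℝ V] {E : Set V} (hE : Convex ℝ E) {x : V} (hx : x ∈ E) :
    x ∈ intrinsicInterior ℝ E ↔ ∀ l ∈ vectorSpan ℝ E, (∀ z ∈ E, ⟪l, z⟫ ≤ ⟪l, x⟫) → l = 0 := by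
  have : Nonempty (affineSpan ℝ E) := ⟨x, subset_affineSpan _ _ hx⟩
  set x' : affineSpan ℝ E := ⟨x, subset_affineSpan _ _ hx⟩ with hx'
  set g := (AffineIsometryEquiv.vaddConst ℝ x').toHomeomorph with hg
  set A : Set (affineSpan ℝ E).direction := {w | (w : V) + x ∈ E} with hA
  have hgA : g ⁻¹' ((↑) ⁻¹' E) = A := rfl
  have hmem : x ∈ intrinsicInterior ℝ E ↔ (0 : (affineSpan ℝ E).direction) ∈ interior A := by
    rw [← hgA, ← g.preimage_interior, Set.mem_preimage, mem_intrinsicInterior]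
    have hg0 : g 0 = x' := by simp [hg]
    rw [hg0]
    constructor
    · rintro ⟨y, hy, hyx⟩
      rwa [show x' = y from Subtype.ext hyx.symm]
    · exact fun h => ⟨x', h, rfl⟩
  have hAc : Convex ℝ A := by
    have := (hE.translate_preimage_left x).linear_preimage (affineSpan ℝ E).direction.subtype
    exact this
  have hAne : (interior A).Nonempty := by
    obtain ⟨_, y, hy, rfl⟩ := Set.Nonempty.intrinsicInterior hE ⟨x, hx⟩
    rw [← hgA, ← g.preimage_interior]
    exact ⟨g.symm y, by simpa using hy⟩
  rw [hmem, ← direction_affineSpan]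
  constructor
  · intro h0 l hl hmax
    have hc : Continuous fun t : ℝ => t • (⟨l, hl⟩ : (affineSpan ℝ E).direction) := by fun_prop
    have hnear : ∀ᶠ t : ℝ in nhds 0, t • (⟨l, hl⟩ : (affineSpan ℝ E).direction) ∈ A :=
      hc.continuousAt.preimage_mem_nhds (by simpa using mem_interior_iff_mem_nhds.1 h0)
    obtain ⟨t, ht, htpos⟩ :=
      ((hnear.filter_mono nhdsWithin_le_nhds).and (self_mem_nhdsWithin (s := Set.Ioi 0))).exists
    have h1 := hmax _ ht
    simp only [Submodule.coe_smul, inner_add_right, inner_smul_right] at h1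
    have h2 : t * ⟪l, l⟫ ≤ 0 := by linarith
    have h3 : ⟪l, l⟫ ≤ 0 := nonpos_of_mul_nonpos_right h2 htpos
    exact inner_self_eq_zero.1 (h3.antisymm real_inner_self_nonneg)
  · intro h
    by_contra h0
    obtain ⟨f, hf0, hf⟩ := geometric_hahn_banach_of_nonempty_interior_point hAc h0 hAne
    refine hf0 ?_
    obtain ⟨l, rfl⟩ := (InnerProductSpace.toDual ℝ (affineSpan ℝ E).direction).surjective f
    have hl : (l : V) = 0 := h l l.2 fun z hz => by
      have hzx : z - x ∈ (affineSpan ℝ E).direction :=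
        AffineSubspace.vsub_mem_direction (subset_affineSpan _ _ hz) (subset_affineSpan _ _ hx)
      have := hf ⟨z - x, hzx⟩ (by simpa [hA] using hz)
      simpa [inner_sub_right] using this
    rw [Submodule.coe_eq_zero.1 hl, map_zero]

/-- The maximum of a linear functional on a polytope is attained only on the convex hull of the
generators attaining it. -/
theorem mem_convexHull_of_inner_eq {s : Finset V} {l y : V} {m : ℝ} (hm : ∀ p ∈ s, ⟪l, p⟫ ≤ m)
    (hy : y ∈ convexHull ℝ (s : Set V)) (hly : ⟪l, y⟫ = m) :
    y ∈ convexHull ℝ {p | p ∈ s ∧ ⟪l, p⟫ = m} := by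
  obtain ⟨w, hw0, hw1, rfl⟩ := Finset.mem_convexHull'.1 hy
  have hsum : ∑ p ∈ s, w p * (m - ⟪l, p⟫) = 0 := by
    simp only [inner_sum, inner_smul_right] at hly
    simp only [mul_sub, Finset.sum_sub_distrib, ← Finset.sum_mul, hw1, hly]
    ring
  have hz := (Finset.sum_eq_zero_iff_of_nonneg fun p hp =>
    mul_nonneg (hw0 p hp) (sub_nonneg.2 (hm p hp))).1 hsum
  classical
  have hfil : ∀ p ∈ s, ¬ ⟪l, p⟫ = m → w p = 0 := fun p hp hne =>
    (mul_eq_zero.1 (hz p hp)).resolve_right (sub_ne_zero.2 (Ne.symm hne))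
  have h1 : ∑ p ∈ s with ⟪l, p⟫ = m, w p • p = ∑ p ∈ s, w p • p := by
    refine Finset.sum_subset (Finset.filter_subset _ _) fun p hp hp' => ?_
    rw [hfil p hp fun h => hp' (Finset.mem_filter.2 ⟨hp, h⟩), zero_smul]
  have h2 : ∑ p ∈ s with ⟪l, p⟫ = m, w p = ∑ p ∈ s, w p := by
    refine Finset.sum_subset (Finset.filter_subset _ _) fun p hp hp' => ?_
    rw [hfil p hp fun h => hp' (Finset.mem_filter.2 ⟨hp, h⟩)]
  rw [← h1]
  have := Finset.mem_convexHull' (R := ℝ) (s := s.filter fun p => ⟪l, p⟫ = m)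
    (x := ∑ p ∈ s with ⟪l, p⟫ = m, w p • p)
  rw [Finset.coe_filter] at this
  exact this.2 ⟨w, fun p hp => hw0 p (Finset.mem_filter.1 hp).1, h2.trans hw1, rfl⟩

theorem inner_le_of_mem_convexHull {s : Finset V} {l y : V} {m : ℝ} (hm : ∀ p ∈ s, ⟪l, p⟫ ≤ m)
    (hy : y ∈ convexHull ℝ (s : Set V)) : ⟪l, y⟫ ≤ m :=
  convexHull_min (t := {z | ⟪l, z⟫ ≤ m}) hm
    ((convex_Iic m).linear_preimage (innerSL ℝ l : V →ₗ[ℝ] ℝ)) hy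

/-- The normal cone of a polytope at `x`, within the direction of the polytope, cut by the
hyperplane on which `∑ p ∈ s, ⟪l, x - p⟫ = 1`. -/
def normalSlice (s : Finset V) (x : V) : Set V :=
  {l | l ∈ vectorSpan ℝ (convexHull ℝ (s : Set V)) ∧ (∀ p ∈ s, 0 ≤ ⟪l, x - p⟫) ∧
    ∑ p ∈ s, ⟪l, x - p⟫ = 1}

theorem convex_normalSlice (s : Finset V) (x : V) : Convex ℝ (normalSlice s x) := by
  rintro l ⟨hl, hl0, hl1⟩ m ⟨hm, hm0, hm1⟩ a b ha hb hab
  refine ⟨Submodule.add_mem _ (Submodule.smul_mem _ _ hl) (Submodule.smul_mem _ _ hm),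
    fun p hp => ?_, ?_⟩
  · rw [inner_add_left, real_inner_smul_left, real_inner_smul_left]
    exact add_nonneg (mul_nonneg ha (hl0 p hp)) (mul_nonneg hb (hm0 p hp))
  · simp only [inner_add_left, real_inner_smul_left, Finset.sum_add_distrib, ← Finset.mul_sum,
      hl1, hm1]
    linarith

theorem mem_orthogonal_vectorSpan {F : Set V} {l : V} (h : ∀ y ∈ F, ∀ z ∈ F, ⟪l, y⟫ = ⟪l, z⟫) :
    l ∈ (vectorSpan ℝ F)ᗮ := by
  have hle : vectorSpan ℝ F ≤ (ℝ ∙ l)ᗮ := by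
    rw [vectorSpan, Submodule.span_le]
    rintro _ ⟨y, hy, z, hz, rfl⟩
    rw [SetLike.mem_coe, Submodule.mem_orthogonal_singleton_iff_inner_right]
    simp only [vsub_eq_sub, inner_sub_right, h y hy z hz, sub_self]
  exact (Submodule.mem_orthogonal' _ _).2 fun v hv =>
    Submodule.mem_orthogonal_singleton_iff_inner_right.1 (hle hv)

theorem eq_zero_of_inner_sub_eq_zero {s : Finset V} {l x : V}
    (hl : l ∈ vectorSpan ℝ (convexHull ℝ (s : Set V))) (h : ∀ p ∈ s, ⟪l, x - p⟫ = 0) : l = 0 := by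
  have hs : l ∈ (vectorSpan ℝ (s : Set V))ᗮ := mem_orthogonal_vectorSpan fun y hy z hz => by
    have hy' := h y hy
    have hz' := h z hz
    rw [inner_sub_right] at hy' hz'
    linarith
  rw [← direction_affineSpan, affineSpan_convexHull, direction_affineSpan] at hl
  exact inner_self_eq_zero.1 (Submodule.inner_right_of_mem_orthogonal hl hs)

theorem isCompact_normalSlice [FiniteDimensional ℝ V] (s : Finset V) (x : V) : IsCompact (normalSlice s x) := by
  set W := vectorSpan ℝ (convexHull ℝ (s : Set V)) with hW
  let f : W →ₗ[ℝ] (s → ℝ) :=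
    LinearMap.pi fun p => (innerSL ℝ (x - p : V) : V →ₗ[ℝ] ℝ) ∘ₗ W.subtype
  have hf : ∀ l p, f l p = ⟪(l : V), x - p⟫ := fun l p => real_inner_comm _ _
  have hinj : LinearMap.ker f = ⊥ := by
    rw [LinearMap.ker_eq_bot']
    intro l hl
    refine Subtype.ext (eq_zero_of_inner_sub_eq_zero (x := x) l.2 fun p hp => ?_)
    rw [← hf l ⟨p, hp⟩, hl, Pi.zero_apply]
  have hcpt : IsCompact {y : s → ℝ | y ∈ Set.Icc 0 1 ∧ ∑ p, y p = 1} :=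
    isCompact_Icc.inter_right (isClosed_eq (by fun_prop) continuous_const)
  convert ((LinearMap.isClosedEmbedding_of_injective hinj).isCompact_preimage hcpt).image
    continuous_subtype_val using 1
  ext l
  simp only [normalSlice, Set.mem_ofPred_eq, Set.mem_image, Set.mem_preimage]
  have hsum : ∀ l : W, ∑ p, f l p = ∑ p ∈ s, ⟪(l : V), x - p⟫ := fun l => by
    simp only [hf]
    exact Finset.sum_coe_sort s fun p => ⟪(l : V), x - p⟫
  constructor
  · rintro ⟨hl, h0, h1⟩
    refine ⟨⟨l, hl⟩, ⟨⟨fun p => ?_, fun p => ?_⟩, (hsum _).trans h1⟩, rfl⟩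
    · rw [hf]; exact h0 p p.2
    · rw [hf, Pi.one_apply, ← h1]
      exact Finset.single_le_sum h0 p.2
  · rintro ⟨l, ⟨⟨h0, -⟩, h1⟩, rfl⟩
    exact ⟨l.2, fun p hp => by simpa [hf] using h0 ⟨p, hp⟩, (hsum l).symm.trans h1⟩

theorem exists_mem_normalSlice_of_ne_zero {s : Finset V} {l x : V}
    (hl : l ∈ vectorSpan ℝ (convexHull ℝ (s : Set V))) (h : ∀ p ∈ s, 0 ≤ ⟪l, x - p⟫)
    (hl0 : l ≠ 0) : ∃ c : ℝ, 0 < c ∧ c • l ∈ normalSlice s x := by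
  have hpos : 0 < ∑ p ∈ s, ⟪l, x - p⟫ := (Finset.sum_nonneg h).lt_of_ne' fun h0 =>
    hl0 (eq_zero_of_inner_sub_eq_zero hl ((Finset.sum_eq_zero_iff_of_nonneg h).1 h0))
  refine ⟨_, inv_pos.2 hpos, Submodule.smul_mem _ _ hl, fun p hp => ?_, ?_⟩
  · rw [real_inner_smul_left]
    exact mul_nonneg (inv_pos.2 hpos).le (h p hp)
  · simp only [real_inner_smul_left, ← Finset.mul_sum]
    exact inv_mul_cancel₀ hpos.ne'

theorem ne_zero_of_mem_normalSlice {s : Finset V} {l x : V} (hl : l ∈ normalSlice s x) :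
    l ≠ 0 := by
  rintro rfl
  simpa using hl.2.2

theorem mem_intrinsicInterior_iff_normalSlice_eq_empty [FiniteDimensional ℝ V] {s : Finset V}
    {x : V} (hx : x ∈ convexHull ℝ (s : Set V)) :
    x ∈ intrinsicInterior ℝ (convexHull ℝ (s : Set V)) ↔ ¬ (normalSlice s x).Nonempty := by
  rw [mem_intrinsicInterior_iff_forall_inner (convex_convexHull ℝ _) hx]
  constructor
  · rintro h ⟨l, hl⟩
    refine ne_zero_of_mem_normalSlice hl (h l hl.1 fun z hz => ?_)
    exact inner_le_of_mem_convexHull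
      (fun p hp => by simpa [inner_sub_right] using hl.2.1 p hp) hz
  · intro h l hl hmax
    by_contra hl0
    obtain ⟨c, -, hc⟩ := exists_mem_normalSlice_of_ne_zero hl (x := x) (fun p hp => by
      simpa [inner_sub_right] using hmax p (subset_convexHull ℝ _ hp)) hl0
    exact h ⟨_, hc⟩

/-- The part of `normalSlice s x` consisting of the functionals exposing precisely the face `F`. -/
def normalCell (s : Finset V) (x : V) (F : Set V) : Set V :=
  {l | l ∈ vectorSpan ℝ (convexHull ℝ (s : Set V)) ∧ l ∈ (vectorSpan ℝ F)ᗮ ∧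
    (∑ p ∈ s, ⟪l, x - p⟫ = 1) ∧ ∀ p ∈ s, p ∉ F → 0 < ⟪l, x - p⟫}

theorem inner_eq_of_mem_orthogonal_vectorSpan {F : Set V} {l x y : V}
    (hl : l ∈ (vectorSpan ℝ F)ᗮ) (hx : x ∈ F) (hy : y ∈ F) : ⟪l, y⟫ = ⟪l, x⟫ := by
  have := Submodule.inner_left_of_mem_orthogonal (vsub_mem_vectorSpan ℝ hy hx) hl
  rw [vsub_eq_sub, inner_sub_right] at this
  linarith

theorem normalCell_subset_normalSlice {s : Finset V} {x : V} {F : Set V} (hx : x ∈ F) :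
    normalCell s x F ⊆ normalSlice s x := by
  rintro l ⟨hl, hlF, h1, h⟩
  refine ⟨hl, fun p hp => ?_, h1⟩
  by_cases hpF : p ∈ F
  · rw [inner_sub_right, inner_eq_of_mem_orthogonal_vectorSpan hlF hx hpF, sub_self]
  · exact (h p hp hpF).le

theorem eq_of_mem_normalCell {s : Finset V} {x l : V} {F : Set V} (hx : x ∈ F)
    (hFs : F ⊆ convexHull ℝ (s : Set V)) (hF : Convex ℝ F) (hl : l ∈ normalCell s x F) :
    F = {y | y ∈ convexHull ℝ (s : Set V) ∧ ⟪l, y⟫ = ⟪l, x⟫} := by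
  have hm : ∀ p ∈ s, ⟪l, p⟫ ≤ ⟪l, x⟫ := fun p hp => by
    simpa [inner_sub_right] using (normalCell_subset_normalSlice hx hl).2.1 p hp
  refine Set.Subset.antisymm
    (fun y hy => ⟨hFs hy, inner_eq_of_mem_orthogonal_vectorSpan hl.2.1 hx hy⟩) ?_
  rintro y ⟨hy, hyl⟩
  refine convexHull_min ?_ hF (mem_convexHull_of_inner_eq hm hy hyl)
  rintro p ⟨hp, hpl⟩
  by_contra hpF
  have := hl.2.2.2 p hp hpF
  rw [inner_sub_right] at this
  linarith

theorem isExposed_of_mem_normalSlice {s : Finset V} {x l : V}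
    (hx : x ∈ convexHull ℝ (s : Set V)) (hl : l ∈ normalSlice s x) :
    IsExposed ℝ (convexHull ℝ (s : Set V))
      {y | y ∈ convexHull ℝ (s : Set V) ∧ ⟪l, y⟫ = ⟪l, x⟫} := by
  refine fun _ => ⟨innerSL ℝ l, Set.ext fun y => and_congr_right fun hy => ?_⟩
  have hm : ∀ z ∈ convexHull ℝ (s : Set V), ⟪l, z⟫ ≤ ⟪l, x⟫ := fun z hz =>
    inner_le_of_mem_convexHull (fun p hp => by simpa [inner_sub_right] using hl.2.1 p hp) hz
  simp only [innerSL_apply_apply]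
  exact ⟨fun h z hz => h ▸ hm z hz, fun h => (hm y hy).antisymm (h x hx)⟩

theorem mem_normalCell_of_mem_normalSlice {s : Finset V} {x l : V}
    (hl : l ∈ normalSlice s x) :
    l ∈ normalCell s x {y | y ∈ convexHull ℝ (s : Set V) ∧ ⟪l, y⟫ = ⟪l, x⟫} := by
  refine ⟨hl.1, ?_, hl.2.2, fun p hp hpF => (hl.2.1 p hp).lt_of_ne fun h => hpF
    ⟨subset_convexHull ℝ _ hp, ?_⟩⟩
  · exact mem_orthogonal_vectorSpan fun y hy z hz => hy.2.trans hz.2.symm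
  · rw [inner_sub_right] at h
    linarith

theorem normalCell_nonempty [FiniteDimensional ℝ V] {s : Finset V} {x : V} {F : Set V}
    (hF : IsExposed ℝ (convexHull ℝ (s : Set V)) F) (hx : x ∈ F)
    (hne : F ≠ convexHull ℝ (s : Set V)) : (normalCell s x F).Nonempty := by
  obtain ⟨f, hf⟩ := hF ⟨x, hx⟩
  obtain ⟨l, rfl⟩ := (InnerProductSpace.toDual ℝ V).surjective f
  simp only [InnerProductSpace.toDual_apply_apply] at hf
  have hxE : x ∈ convexHull ℝ (s : Set V) := hF.subset hx
  set W := vectorSpan ℝ (convexHull ℝ (s : Set V)) with hW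
  set m : V := W.starProjection l with hm
  have hmW : m ∈ W := W.starProjection_apply_mem l
  have hml : ∀ w ∈ W, ⟪m, w⟫ = ⟪l, w⟫ := fun w hw => by
    have := W.starProjection_inner_eq_zero l w hw
    rw [inner_sub_left] at this
    linarith
  have hsub : ∀ p ∈ s, x - p ∈ W := fun p hp =>
    vsub_mem_vectorSpan ℝ hxE (subset_convexHull ℝ _ hp)
  have hmax : ∀ z ∈ convexHull ℝ (s : Set V), ⟪l, z⟫ ≤ ⟪l, x⟫ := by
    rw [hf] at hx
    exact hx.2
  have h0 : ∀ p ∈ s, 0 ≤ ⟪m, x - p⟫ := fun p hp => by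
    rw [hml _ (hsub p hp), inner_sub_right]
    linarith [hmax p (subset_convexHull ℝ _ hp)]
  have hpos : ∀ p ∈ s, p ∉ F → 0 < ⟪m, x - p⟫ := fun p hp hpF => by
    refine (h0 p hp).lt_of_ne fun h => hpF ?_
    rw [hml _ (hsub p hp), inner_sub_right] at h
    rw [hf]
    exact ⟨subset_convexHull ℝ _ hp, fun z hz => by linarith [hmax z hz]⟩
  have hmne : m ≠ 0 := by
    intro hm0
    refine hne (hF.subset.antisymm (convexHull_min (fun p hp => ?_)
      (hF.convex (convex_convexHull ℝ _))))
    by_contra hpF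
    simpa [hm0] using hpos p hp hpF
  obtain ⟨c, hc, hcm⟩ := exists_mem_normalSlice_of_ne_zero hmW h0 hmne
  refine ⟨c • m, hcm.1, Submodule.smul_mem _ _ ?_, hcm.2.2, fun p hp hpF => ?_⟩
  · refine mem_orthogonal_vectorSpan fun y hy z hz => ?_
    have h := hml _ (vsub_mem_vectorSpan ℝ (hF.subset hy) (hF.subset hz))
    rw [hf] at hy hz
    simp only [vsub_eq_sub, inner_sub_right] at h
    linarith [hy.2 z hz.1, hz.2 y hy.1]
  · rw [real_inner_smul_left]
    exact mul_pos hc (hpos p hp hpF)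

/-- Euler's relation for the interval of the face lattice of a polytope between the smallest face
containing a relative boundary point `x` and the whole polytope. -/
theorem sum_proper_faces_eq_neg_one [FiniteDimensional ℝ V] {s : Finset V} {x : V}
    (hx : x ∈ convexHull ℝ (s : Set V)) (hK : (normalSlice s x).Nonempty) (J : Finset (Set V))
    (hJ : ∀ F, F ∈ J ↔ IsExposed ℝ (convexHull ℝ (s : Set V)) F ∧ x ∈ F ∧
      F ≠ convexHull ℝ (s : Set V)) :
    ∑ F ∈ J, (-1 : ℤ) ^ (Module.finrank ℝ (vectorSpan ℝ (convexHull ℝ (s : Set V)))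
      - Module.finrank ℝ (vectorSpan ℝ F)) = -1 := by
  classical
  obtain ⟨l₀, hl₀⟩ := hK
  set W := vectorSpan ℝ (convexHull ℝ (s : Set V)) with hW
  set φ : StrongDual ℝ V := innerSL ℝ (∑ p ∈ s, (x - p)) with hφ
  have hφl : ∀ l, φ l = ∑ p ∈ s, ⟪l, x - p⟫ := fun l => by
    rw [hφ, innerSL_apply_apply, sum_inner]
    exact Finset.sum_congr rfl fun p _ => real_inner_comm _ _
  let D : Set V → Submodule ℝ V := fun F => (vectorSpan ℝ F)ᗮ ⊓ W
  let S : Set V → AffineSubspace ℝ V := fun F => (D F).toAffineSubspace ⊓ levelSubspace φ l₀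
  let U : Set V → Set V := fun F => {l | ∀ p ∈ s, p ∉ F → 0 < ⟪l, x - p⟫}
  have hSU : ∀ F, (S F : Set V) ∩ U F = normalCell s x F := fun F => by
    ext l
    simp only [S, D, U, normalCell, Set.mem_inter_iff, SetLike.mem_coe, AffineSubspace.mem_inf_iff,
      mem_levelSubspace, Set.mem_ofPred_eq, hφl, hl₀.2.2, Submodule.mem_toAffineSubspace,
      Submodule.mem_inf]
    tauto
  have hUo : ∀ F ∈ J, IsOpen (U F) := fun F _ => by
    simp only [U, Set.ofPred_forall]
    exact isOpen_biInter_finset fun p _ => isOpen_iInter_of_finite fun _ =>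
      isOpen_lt continuous_const (by fun_prop)
  have hUc : ∀ F ∈ J, Convex ℝ (U F) := fun F _ l hl m hm a b ha hb hab p hp hpF => by
    rw [inner_add_left, real_inner_smul_left, real_inner_smul_left]
    have h1 := hl p hp hpF
    have h2 := hm p hp hpF
    rcases ha.eq_or_lt with rfl | ha
    · obtain rfl : b = 1 := by linarith
      simpa using h2
    · have := mul_pos ha h1
      have := mul_nonneg hb h2.le
      linarith
  have heuler := sum_relOpenEuler_eq_of_partition J U hUo hUc S _ (isCompact_normalSlice s x)
    (convex_normalSlice s x) fun l => by
      simp only [hSU]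
      by_cases hl : l ∈ normalSlice s x
      · rw [Set.indicator_of_mem hl, Finset.sum_eq_single
          {y | y ∈ convexHull ℝ (s : Set V) ∧ ⟪l, y⟫ = ⟪l, x⟫},
          Set.indicator_of_mem (mem_normalCell_of_mem_normalSlice hl)]
        · intro F hF hne
          refine Set.indicator_of_notMem (fun hlF => hne ?_) _
          obtain ⟨hF, hxF, -⟩ := (hJ F).1 hF
          exact eq_of_mem_normalCell hxF hF.subset (hF.convex (convex_convexHull ℝ _)) hlF
        · refine fun h => absurd ((hJ _).2 ⟨isExposed_of_mem_normalSlice hx hl, ⟨hx, rfl⟩, ?_⟩) h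
          intro hE
          have hall : ∀ p ∈ s, ⟪l, x - p⟫ = 0 := fun p hp => by
            have : p ∈ {y | y ∈ convexHull ℝ (s : Set V) ∧ ⟪l, y⟫ = ⟪l, x⟫} :=
              hE.ge (subset_convexHull ℝ _ hp)
            rw [inner_sub_right, this.2, sub_self]
          exact ne_zero_of_mem_normalSlice hl (eq_zero_of_inner_sub_eq_zero hl.1 hall)
      · rw [Set.indicator_of_notMem hl, Finset.sum_eq_zero]
        exact fun F hF => Set.indicator_of_notMem
          (fun hlF => hl (normalCell_subset_normalSlice ((hJ F).1 hF).2.1 hlF)) _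
  rw [if_pos ⟨l₀, hl₀⟩] at heuler
  refine Eq.trans ?_ (congrArg Neg.neg heuler)
  rw [← Finset.sum_neg_distrib]
  refine Finset.sum_congr rfl fun F hF => ?_
  obtain ⟨hF, hxF, hne⟩ := (hJ F).1 hF
  obtain ⟨l, hl⟩ := normalCell_nonempty hF hxF hne
  have hlD : l ∈ D F := ⟨hl.2.1, hl.1⟩
  rw [relOpenEuler_of_nonempty (by rw [hSU]; exact ⟨l, hl⟩)]
  have hdir : (S F).direction = D F ⊓ LinearMap.ker (φ : V →ₗ[ℝ] ℝ) := by
    rw [direction_inf_levelSubspace (x := l) (Submodule.mem_toAffineSubspace.2 hlD)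
      (by rw [hφl, hφl, hl.2.2.1, hl₀.2.2]), Submodule.toAffineSubspace_direction]
  have h1 := Submodule.finrank_inf_ker_add_one (D F) (φ : V →ₗ[ℝ] ℝ) fun hle => by
    have h0 : φ l = 0 := hle hlD
    rw [hφl, hl.2.2.1] at h0
    exact one_ne_zero h0
  have h2 := Submodule.finrank_add_inf_finrank_orthogonal (vectorSpan_mono ℝ hF.subset)
  have h3 : Module.finrank ℝ W - Module.finrank ℝ (vectorSpan ℝ F) =
      Module.finrank ℝ (D F ⊓ LinearMap.ker (φ : V →ₗ[ℝ] ℝ) : Submodule ℝ V) + 1 := by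
    rw [h1, ← h2, Nat.add_sub_cancel_left]
  rw [hdir, h3, pow_succ, mul_neg_one]

end Polytope

/-- Inclusion–exclusion for the relative interior of a polytope (the indicator identity
underlying characteristic cycles of orbits): if `E` is a polytope (convex hull of a
nonempty finite set) and `𝒻` is the (finite) collection of all nonempty faces `F` of `E`
(taken here as the exposed faces of `E`, including `E` itself), then
`1_{relint E} = Σ_{F ∈ 𝒻} (-1)^{dim E - dim F} 1_F` as functions `ℝⁿ → ℤ`. -/
theorem relint_inclusion_exclusion {n : ℕ} (s : Finset (EuclideanSpace ℝ (Fin n)))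
    (hs : s.Nonempty)
    (𝒻 : Finset (Set (EuclideanSpace ℝ (Fin n))))
    (h𝒻 : ∀ F : Set (EuclideanSpace ℝ (Fin n)),
      F ∈ 𝒻 ↔ (IsExposed ℝ (convexHull ℝ (s : Set (EuclideanSpace ℝ (Fin n)))) F ∧
        F.Nonempty))
    (x : EuclideanSpace ℝ (Fin n)) :
    Set.indicator (intrinsicInterior ℝ (convexHull ℝ (s : Set (EuclideanSpace ℝ (Fin n)))))
        (fun _ => (1 : ℤ)) x
      = ∑ F ∈ 𝒻,
          (-1 : ℤ) ^ (Module.finrank ℝ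
              (vectorSpan ℝ (convexHull ℝ (s : Set (EuclideanSpace ℝ (Fin n)))))
            - Module.finrank ℝ (vectorSpan ℝ F)) *
            Set.indicator F (fun _ => (1 : ℤ)) x := by
  classical
  set E := convexHull ℝ (s : Set (EuclideanSpace ℝ (Fin n))) with hE
  by_cases hx : x ∈ E
  swap
  · rw [Set.indicator_of_notMem fun h => hx (intrinsicInterior_subset h)]
    refine (Finset.sum_eq_zero fun F hF => ?_).symm
    rw [Set.indicator_of_notMem fun h => hx (((h𝒻 F).1 hF).1.subset h), mul_zero]
  have hE𝒻 : E ∈ 𝒻 := (h𝒻 E).2 ⟨IsExposed.refl E, ⟨x, hx⟩⟩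
  set J := (𝒻.erase E).filter (x ∈ ·) with hJdef
  have hJ : ∀ F, F ∈ J ↔ IsExposed ℝ E F ∧ x ∈ F ∧ F ≠ E := fun F => by
    rw [hJdef, Finset.mem_filter, Finset.mem_erase, h𝒻]
    exact ⟨fun ⟨⟨h1, h2, _⟩, h3⟩ => ⟨h2, h3, h1⟩, fun ⟨h1, h2, h3⟩ => ⟨⟨h3, h1, ⟨x, h2⟩⟩, h2⟩⟩
  have hsum : ∑ F ∈ 𝒻, (-1 : ℤ) ^ (Module.finrank ℝ (vectorSpan ℝ E)
      - Module.finrank ℝ (vectorSpan ℝ F)) * Set.indicator F (fun _ => (1 : ℤ)) x =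
      1 + ∑ F ∈ J, (-1 : ℤ) ^ (Module.finrank ℝ (vectorSpan ℝ E)
      - Module.finrank ℝ (vectorSpan ℝ F)) := by
    rw [← Finset.add_sum_erase _ _ hE𝒻, hJdef, Finset.sum_filter]
    simp [Set.indicator_apply, hx]
  rw [hsum]
  by_cases hK : (normalSlice s x).Nonempty
  · rw [sum_proper_faces_eq_neg_one hx hK J hJ, Set.indicator_of_notMem fun h =>
      (mem_intrinsicInterior_iff_normalSlice_eq_empty hx).1 h hK]
    rfl
  · rw [Set.indicator_of_mem ((mem_intrinsicInterior_iff_normalSlice_eq_empty hx).2 hK),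
      Finset.sum_eq_zero, add_zero]
    intro F hF
    obtain ⟨hF, hxF, hne⟩ := (hJ F).1 hF
    exact absurd ((normalCell_nonempty hF hxF hne).mono (normalCell_subset_normalSlice hxF)) hK
end
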